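/- arXiv:2105.08372 — 6 statements merged into one kernel-verified Lean document; each statement's English description precedes it below -/
import Mathlib

section
/- Let q ≥ 2 be an integer and let μ(β) = ∑_{i∈Z_q} w_L(i)·exp(−β·w_L(i))/Z(β) denote the mean Lee weight under the Boltzmann distribution φ*_β. Then μ is strictly decreasing on ℝ. -/
/-- The Lee weight of an element of `ZMod q`: `min(a, q - a)` for the least
nonnegative residue `a`. -/
def leeWt (q : ℕ) [NeZero q] (a : ZMod q) : ℕ := min a.val (q - a.val)

/-- The partition function `Z(β) = ∑_{e ∈ Z_q} exp(-β · w_L(e))`. -/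
noncomputable def Zfun (q : ℕ) [NeZero q] (β : ℝ) : ℝ :=
  ∑ e : ZMod q, Real.exp (-β * (leeWt q e : ℝ))

/-- The Boltzmann distribution `φ*_β(i) = exp(-β · w_L(i)) / Z(β)` on `Z_q`. -/
noncomputable def boltz (q : ℕ) [NeZero q] (β : ℝ) (i : ZMod q) : ℝ :=
  Real.exp (-β * (leeWt q i : ℝ)) / Zfun q β

/-- The mean Lee weight `μ(β) = ∑_i w_L(i) · φ*_β(i)` under the Boltzmann
distribution. -/
noncomputable def meanLee (q : ℕ) [NeZero q] (β : ℝ) : ℝ :=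
  ∑ i : ZMod q, (leeWt q i : ℝ) * boltz q β i

/-- The Gibbs average of a nonconstant observable `w` is strictly decreasing in the inverse
temperature, in cross-multiplied form. -/
theorem sum_mul_exp_cross_lt {ι : Type*} [Fintype ι] (w : ι → ℝ) {i₀ j₀ : ι}
    (h : w i₀ ≠ w j₀) {a b : ℝ} (hab : a < b) :
    (∑ i, w i * Real.exp (-b * w i)) * ∑ j, Real.exp (-a * w j) <
      (∑ i, w i * Real.exp (-a * w i)) * ∑ j, Real.exp (-b * w j) := by
  set f : ι → ι → ℝ := fun i j ↦
    w i * (Real.exp (-a * w i) * Real.exp (-b * w j) - Real.exp (-b * w i) * Real.exp (-a * w j))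
    with hf
  have hdiff : (∑ i, w i * Real.exp (-a * w i)) * (∑ j, Real.exp (-b * w j)) -
      (∑ i, w i * Real.exp (-b * w i)) * (∑ j, Real.exp (-a * w j)) = ∑ i, ∑ j, f i j := by
    simp only [Finset.sum_mul_sum, ← Finset.sum_sub_distrib, hf]
    refine Finset.sum_congr rfl fun i _ ↦ Finset.sum_congr rfl fun j _ ↦ ?_
    ring
  have hsymm : ∑ i, ∑ j, (f i j + f j i) = 2 * ∑ i, ∑ j, f i j := by
    simp only [Finset.sum_add_distrib]
    rw [Finset.sum_comm (f := fun i j ↦ f j i), two_mul]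
  have hfac (i j : ι) : f i j + f j i = (w i - w j) *
      (Real.exp (-a * w i + -b * w j) - Real.exp (-b * w i + -a * w j)) := by
    simp only [hf, Real.exp_add]
    ring
  have hpos (i j : ι) (hij : w i ≠ w j) : 0 < f i j + f j i := by
    rw [hfac]
    rcases lt_or_gt_of_ne hij with hlt | hgt
    · refine mul_pos_of_neg_of_neg (sub_neg.2 hlt) (sub_neg.2 (Real.exp_lt_exp.2 ?_))
      nlinarith
    · refine mul_pos (sub_pos.2 hgt) (sub_pos.2 (Real.exp_lt_exp.2 ?_))
      nlinarith
  have hnonneg (i j : ι) : 0 ≤ f i j + f j i := by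
    by_cases hij : w i = w j
    · simp [hfac, hij]
    · exact (hpos i j hij).le
  have hsum : 0 < ∑ i, ∑ j, (f i j + f j i) :=
    Finset.sum_pos' (fun i _ ↦ Finset.sum_nonneg fun j _ ↦ hnonneg i j)
      ⟨i₀, Finset.mem_univ _, Finset.sum_pos' (fun j _ ↦ hnonneg i₀ j)
        ⟨j₀, Finset.mem_univ _, hpos i₀ j₀ h⟩⟩
  linarith

theorem leeWt_zero (q : ℕ) [NeZero q] : leeWt q 0 = 0 := by
  simp [leeWt]

theorem leeWt_one {q : ℕ} [NeZero q] (hq : 2 ≤ q) : leeWt q 1 = 1 := by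
  have : Fact (1 < q) := ⟨hq⟩
  rw [leeWt, ZMod.val_one]
  omega

theorem Zfun_pos (q : ℕ) [NeZero q] (β : ℝ) : 0 < Zfun q β :=
  Finset.sum_pos (fun _ _ ↦ Real.exp_pos _) Finset.univ_nonempty

theorem meanLee_eq_div (q : ℕ) [NeZero q] (β : ℝ) :
    meanLee q β =
      (∑ i : ZMod q, (leeWt q i : ℝ) * Real.exp (-β * (leeWt q i : ℝ))) / Zfun q β := by
  simp only [meanLee, boltz, Finset.sum_div, mul_div_assoc]

/-- The mean Lee weight `μ(β)` under the Boltzmann distribution is strictly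
decreasing in `β` on `ℝ`. -/
theorem meanLee_strictAnti (q : ℕ) [NeZero q] (hq : 2 ≤ q) :
    StrictAnti (meanLee q) := by
  intro a b hab
  rw [meanLee_eq_div, meanLee_eq_div, div_lt_div_iff₀ (Zfun_pos q b) (Zfun_pos q a)]
  refine sum_mul_exp_cross_lt (fun i : ZMod q ↦ (leeWt q i : ℝ)) (i₀ := 0) (j₀ := 1) ?_ hab
  simp [leeWt_zero, leeWt_one hq]
end

section
/- Let q ≥ 2 be an integer, let μ(β) = ∑_{i∈Z_q} w_L(i)·exp(−β·w_L(i))/Z(β) be the mean Lee weight under the Boltzmann distribution, and let δ_q = (q²−1)/(4q) if q is odd and δ_q = q/4 if q is even. Then for every real δ with 0 < δ < δ_q there exists a unique β > 0 such that μ(β) = δ. -/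
/-- `δ_q = (q²-1)/(4q)` if `q` is odd, `q/4` if `q` is even. -/
noncomputable def deltaQ (q : ℕ) : ℝ :=
  if Odd q then ((q : ℝ) ^ 2 - 1) / (4 * q) else (q : ℝ) / 4

/-- Mean of `w` under the Gibbs distribution with weights `exp (-β * w i)`. -/
noncomputable def gibbsMean {ι : Type*} [Fintype ι] (w : ι → ℝ) (β : ℝ) : ℝ :=
  (∑ i, w i * Real.exp (-β * w i)) / ∑ i, Real.exp (-β * w i)

lemma sum_exp_pos {ι : Type*} [Fintype ι] [Nonempty ι] (w : ι → ℝ) (β : ℝ) :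
    0 < ∑ i, Real.exp (-β * w i) :=
  Finset.sum_pos (fun _ _ => Real.exp_pos _) Finset.univ_nonempty

lemma continuous_gibbsMean {ι : Type*} [Fintype ι] [Nonempty ι] (w : ι → ℝ) :
    Continuous (gibbsMean w) := by
  unfold gibbsMean
  exact Continuous.div (by fun_prop) (by fun_prop) fun β => (sum_exp_pos w β).ne'

lemma sum_sub_mul_exp {ι : Type*} [Fintype ι] (w : ι → ℝ) (m β : ℝ) :
    ∑ i, (w i - m) * Real.exp (-β * w i) =
      ∑ i, w i * Real.exp (-β * w i) - m * ∑ i, Real.exp (-β * w i) := by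
  simp only [sub_mul, Finset.sum_sub_distrib, Finset.mul_sum]

lemma strictAnti_gibbsMean {ι : Type*} [Fintype ι] {w : ι → ℝ} {i₀ i₁ : ι}
    (hw : w i₀ ≠ w i₁) : StrictAnti (gibbsMean w) := by
  intro β γ hβγ
  have : Nonempty ι := ⟨i₀⟩
  set m := gibbsMean w β with hm
  have hβ : ∑ i, (w i - m) * Real.exp (-β * w i) = 0 := by
    rw [sum_sub_mul_exp, hm, gibbsMean, div_mul_cancel₀ _ (sum_exp_pos w β).ne', sub_self]
  have hsplit (i : ι) : Real.exp (-γ * w i) =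
      Real.exp (-β * w i) * Real.exp (-(γ - β) * w i) := by
    rw [← Real.exp_add]; ring_nf
  have hterm (i : ι) (hi : w i ≠ m) : (w i - m) * Real.exp (-γ * w i) <
      (w i - m) * Real.exp (-β * w i) * Real.exp (-(γ - β) * m) := by
    rw [hsplit, ← mul_assoc]
    have hpos := Real.exp_pos (-β * w i)
    rcases hi.lt_or_gt with h | h
    · have : Real.exp (-(γ - β) * m) < Real.exp (-(γ - β) * w i) :=
        Real.exp_lt_exp.2 (by nlinarith)
      exact mul_lt_mul_of_neg_left this (mul_neg_of_neg_of_pos (by linarith) hpos)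
    · have : Real.exp (-(γ - β) * w i) < Real.exp (-(γ - β) * m) :=
        Real.exp_lt_exp.2 (by nlinarith)
      exact mul_lt_mul_of_pos_left this (mul_pos (by linarith) hpos)
  obtain ⟨j, hj⟩ : ∃ j, w j ≠ m := by
    by_contra! h
    exact hw ((h i₀).trans (h i₁).symm)
  have hγ : ∑ i, (w i - m) * Real.exp (-γ * w i) < 0 := by
    rw [← zero_mul (Real.exp (-(γ - β) * m)), ← hβ, Finset.sum_mul]
    refine Finset.sum_lt_sum (fun i _ => ?_) ⟨j, Finset.mem_univ _, hterm j hj⟩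
    by_cases hi : w i = m
    · simp [hi]
    · exact (hterm i hi).le
  rw [sum_sub_mul_exp] at hγ
  rw [gibbsMean, div_lt_iff₀ (sum_exp_pos w γ)]
  linarith

lemma tendsto_gibbsMean_atTop {ι : Type*} [Fintype ι] {w : ι → ℝ} (hw : ∀ i, 0 ≤ w i)
    {i₀ : ι} (h₀ : w i₀ = 0) :
    Filter.Tendsto (gibbsMean w) Filter.atTop (nhds 0) := by
  have hnum : Filter.Tendsto (fun β : ℝ => ∑ i, w i * Real.exp (-β * w i))
      Filter.atTop (nhds 0) := by
    rw [← Finset.sum_const_zero (ι := ι) (s := Finset.univ)]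
    refine tendsto_finsetSum _ fun i _ => ?_
    rcases (hw i).eq_or_lt with h | h
    · simp [← h]
    · rw [← mul_zero (w i)]
      refine Filter.Tendsto.const_mul _ (Real.tendsto_exp_atBot.comp ?_)
      exact Filter.Tendsto.atBot_mul_const h Filter.tendsto_neg_atTop_atBot
  have hnonneg (β : ℝ) : 0 ≤ ∑ i, w i * Real.exp (-β * w i) :=
    Finset.sum_nonneg fun i _ => mul_nonneg (hw i) (Real.exp_pos _).le
  refine squeeze_zero
    (fun β => div_nonneg (hnonneg β) (Finset.sum_nonneg fun i _ => (Real.exp_pos _).le))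
    (fun β => div_le_self (hnonneg β) ?_) hnum
  calc (1 : ℝ) = Real.exp (-β * w i₀) := by simp [h₀]
    _ ≤ _ := Finset.single_le_sum (f := fun i => Real.exp (-β * w i))
      (fun i _ => (Real.exp_pos _).le) (Finset.mem_univ i₀)

lemma meanLee_eq_gibbsMean (q : ℕ) [NeZero q] (β : ℝ) :
    meanLee q β = gibbsMean (fun i : ZMod q => (leeWt q i : ℝ)) β := by
  simp only [meanLee, boltz, Zfun, gibbsMean, Finset.sum_div, mul_div_assoc]

lemma sum_leeWt_eq_sum_range (q : ℕ) [NeZero q] :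
    ∑ i : ZMod q, leeWt q i = ∑ i ∈ Finset.range q, min i (q - i) := by
  obtain ⟨n, rfl⟩ := Nat.exists_eq_succ_of_ne_zero (NeZero.ne q)
  exact Fin.sum_univ_eq_sum_range (fun i => min i (n + 1 - i)) (n + 1)

lemma sum_range_min_two_mul (k : ℕ) :
    ∑ i ∈ Finset.range (k + k), min i (k + k - i) = k * k := by
  rw [Finset.sum_range_add, ← Finset.sum_add_distrib]
  refine (Finset.sum_congr rfl fun i hi => ?_).trans (by simp : ∑ i ∈ Finset.range k, k = k * k)
  rw [Finset.mem_range] at hi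
  omega

lemma sum_range_min_two_mul_add_one (k : ℕ) :
    ∑ i ∈ Finset.range (k + (k + 1)), min i (k + (k + 1) - i) = k * k + k := by
  rw [Finset.sum_range_add, Finset.sum_range_succ', ← add_assoc, ← Finset.sum_add_distrib]
  congr 1
  · refine (Finset.sum_congr rfl fun i hi => ?_).trans (by simp : ∑ i ∈ Finset.range k, k = k * k)
    rw [Finset.mem_range] at hi
    omega
  · omega

lemma meanLee_zero (q : ℕ) [NeZero q] : meanLee q 0 = deltaQ q := by
  have hq : (q : ℝ) ≠ 0 := Nat.cast_ne_zero.2 (NeZero.ne q)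
  have h : meanLee q 0 = ((∑ i ∈ Finset.range q, min i (q - i) : ℕ) : ℝ) / q := by
    rw [meanLee_eq_gibbsMean, ← sum_leeWt_eq_sum_range]
    simp [gibbsMean, ZMod.card]
  rw [h, deltaQ]
  split_ifs with hodd
  · obtain ⟨k, hk⟩ := hodd
    obtain rfl : q = k + (k + 1) := by omega
    rw [sum_range_min_two_mul_add_one]
    field_simp
    push_cast
    ring
  · obtain ⟨k, rfl⟩ := Nat.not_odd_iff_even.1 hodd
    rw [sum_range_min_two_mul]
    field_simp
    push_cast
    ring

/-- For every `δ` with `0 < δ < δ_q` there is a unique `β > 0` with `μ(β) = δ`. -/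
theorem existsUnique_beta_of_meanLee (q : ℕ) [NeZero q] (hq : 2 ≤ q)
    (δ : ℝ) (h0 : 0 < δ) (h1 : δ < deltaQ q) :
    ∃! β : ℝ, 0 < β ∧ meanLee q β = δ := by
  have : Fact (1 < q) := ⟨hq⟩
  have hmean : meanLee q = gibbsMean (fun i : ZMod q => (leeWt q i : ℝ)) :=
    funext (meanLee_eq_gibbsMean q)
  have hwt_zero : (leeWt q 0 : ℝ) = 0 := by simp [leeWt]
  have hwt_one : (leeWt q 1 : ℝ) ≠ 0 := by
    rw [Nat.cast_ne_zero, leeWt, ZMod.val_one]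
    omega
  have hanti : StrictAnti (meanLee q) :=
    hmean ▸ strictAnti_gibbsMean (i₀ := 0) (i₁ := 1) (by simpa only [hwt_zero] using hwt_one.symm)
  have hcont : Continuous (meanLee q) := hmean ▸ continuous_gibbsMean _
  have hlim : Filter.Tendsto (meanLee q) Filter.atTop (nhds 0) :=
    hmean ▸ tendsto_gibbsMean_atTop (fun _ => Nat.cast_nonneg _) hwt_zero
  obtain ⟨B, hB, hB0⟩ :=
    ((hlim.eventually_lt_const h0).and (Filter.eventually_gt_atTop 0)).exists
  obtain ⟨β, hβ, hβδ⟩ := intermediate_value_Ioo' hB0.le hcont.continuousOn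
    ⟨hB, (meanLee_zero q).symm ▸ h1⟩
  exact ⟨β, ⟨hβ.1, hβδ⟩, fun γ hγ => hanti.injective (hγ.2.trans hβδ.symm)⟩
end

section
/- Let q ≥ 2 and n ≥ 1 be integers and let δ ≥ 0 be real. Then the volume of the n-dimensional Lee ball of radius nδ satisfies |{x ∈ Z_q^n : w_L(x) ≤ nδ}| ≤ exp(n·H⁺_δ), where H⁺_δ = inf_{β ≥ 0} (β·δ + log Z(β)). -/
/-- The Lee weight of a vector: `w_L(x) = ∑_i w_L(x_i)`. -/
def leeWtVec (q n : ℕ) [NeZero q] (x : Fin n → ZMod q) : ℕ :=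
  ∑ i, leeWt q (x i)

/-- `H⁺_δ = inf_{β ≥ 0} (β·δ + log Z(β))`. -/
noncomputable def Hplus (q : ℕ) [NeZero q] (δ : ℝ) : ℝ :=
  ⨅ β : {b : ℝ // 0 ≤ b}, ((β : ℝ) * δ + Real.log (Zfun q (β : ℝ)))

/-- The partition function is multiplicative: summing `exp(-β · w_L)` over `Z_q^n` gives
`Z(β) ^ n`. -/
theorem sum_exp_leeWtVec (q n : ℕ) [NeZero q] (β : ℝ) :
    ∑ x : Fin n → ZMod q, Real.exp (-β * (leeWtVec q n x : ℝ)) = Zfun q β ^ n := by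
  rw [Zfun, Fintype.sum_pow]
  refine Finset.sum_congr rfl fun x _ => ?_
  rw [← Real.exp_sum, leeWtVec, Nat.cast_sum, Finset.mul_sum]

/-- The exponential Markov (Chernoff) bound for the size of a Lee ball. -/
theorem card_lee_ball_le (q n : ℕ) [NeZero q] (r : ℝ) {β : ℝ} (hβ : 0 ≤ β) :
    (Nat.card {x : Fin n → ZMod q // (leeWtVec q n x : ℝ) ≤ r} : ℝ)
      ≤ Real.exp (β * r) * Zfun q β ^ n := by
  classical
  rw [Nat.card_eq_fintype_card, Fintype.card_subtype, Finset.card_eq_sum_ones, Nat.cast_sum,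
    Finset.sum_filter, ← sum_exp_leeWtVec, Finset.mul_sum]
  refine Finset.sum_le_sum fun x _ => ?_
  rw [← Real.exp_add]
  split_ifs with hx
  · rw [Nat.cast_one]
    exact Real.one_le_exp (by linarith [mul_le_mul_of_nonneg_left hx hβ])
  · exact (Real.exp_pos _).le

/-- The volume of the `n`-dimensional Lee ball of radius `nδ` is at most
`exp(n·H⁺_δ)`. -/
theorem lee_ball_card_le_exp_Hplus (q n : ℕ) [NeZero q] (hq : 2 ≤ q)
    (hn : 1 ≤ n) (δ : ℝ) (hδ : 0 ≤ δ) :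
    (Nat.card {x : Fin n → ZMod q // (leeWtVec q n x : ℝ) ≤ n * δ} : ℝ)
      ≤ Real.exp (n * Hplus q δ) := by
  have hn0 : (0 : ℝ) < n := by exact_mod_cast hn
  have hzero : ((leeWtVec q n 0 : ℕ) : ℝ) ≤ n * δ := by
    simpa [leeWtVec, leeWt] using mul_nonneg hn0.le hδ
  have : Nonempty {x : Fin n → ZMod q // (leeWtVec q n x : ℝ) ≤ n * δ} := ⟨⟨0, hzero⟩⟩
  have : Nonempty {b : ℝ // 0 ≤ b} := ⟨⟨0, le_rfl⟩⟩
  have hcard : (0 : ℝ) < Nat.card {x : Fin n → ZMod q // (leeWtVec q n x : ℝ) ≤ n * δ} := by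
    exact_mod_cast Nat.card_pos
  rw [← Real.log_le_iff_le_exp hcard, ← div_le_iff₀' hn0]
  refine le_ciInf fun β => ?_
  rw [div_le_iff₀' hn0, Real.log_le_iff_le_exp hcard]
  refine (card_lee_ball_le q n (n * δ) β.2).trans_eq ?_
  rw [mul_add, Real.exp_add, Real.exp_nat_mul (Real.log _), Real.exp_log (Zfun_pos q _),
    mul_left_comm]
end

section
/- Let q ≥ 2, n ≥ 1, M ≥ 2 be integers and let w ∈ ℕ be such that the Lee sphere S = {e ∈ Z_q^n : w_L(e) = w} is nonempty. Draw a random code C = (C_1, …, C_M) with the M codewords independent and uniformly distributed on Z_q^n, draw the error vector E uniformly on S independently of the code, and set Y = C_1 + E. Let the decoder declare an error whenever there exists an index j ≠ 1 with d_L(C_j, Y) ≤ d_L(C_1, Y) (i.e., minimum-Lee-distance decoding fails or ties). Then the expected block error probability satisfies E[P_B] ≤ min(1, (M−1)·|{x ∈ Z_q^n : w_L(x) ≤ w}| / q^n). -/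
/-- The Lee distance of two vectors: `d_L(x,y) = w_L(x - y)`. -/
def dLeeVec (q n : ℕ) [NeZero q] (x y : Fin n → ZMod q) : ℕ :=
  leeWtVec q n (x - y)

theorem leeWt_neg (q : ℕ) [NeZero q] (a : ZMod q) : leeWt q (-a) = leeWt q a := by
  unfold leeWt
  have h := ZMod.val_lt a
  rw [ZMod.neg_val]
  split_ifs with h0
  · simp [h0]
  · omega

theorem leeWtVec_neg (q n : ℕ) [NeZero q] (x : Fin n → ZMod q) :
    leeWtVec q n (-x) = leeWtVec q n x := by
  simp [leeWtVec, leeWt_neg]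

theorem dLeeVec_self_add (q n : ℕ) [NeZero q] (x e : Fin n → ZMod q) :
    dLeeVec q n x (x + e) = leeWtVec q n e := by
  rw [dLeeVec, sub_add_cancel_left, leeWtVec_neg]

/-- Union bound by counting: over a finite group, the pairs `(C, e)` with `e` in `S` for which
some `C j`, `j ≠ i₀`, satisfies `C j - (C i₀ + e) ∈ B`. Replacing `C j` by an arbitrary element
makes the difference independent of the code. -/
theorem card_exists_sub_mem_mul_card_le {ι G : Type*} [Finite ι] [AddCommGroup G] [Finite G]
    (i₀ : ι) (S B : G → Prop) :
    Nat.card {Ce : (ι → G) × G // S Ce.2 ∧ ∃ j, j ≠ i₀ ∧ B (Ce.1 j - (Ce.1 i₀ + Ce.2))}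
        * Nat.card G
      ≤ Nat.card {j : ι // j ≠ i₀} * (Nat.card (ι → G) * (Nat.card {e // S e}
        * Nat.card {x // B x})) := by
  classical
  simp only [← Nat.card_prod]
  let f : {Ce : (ι → G) × G // S Ce.2 ∧ ∃ j, j ≠ i₀ ∧ B (Ce.1 j - (Ce.1 i₀ + Ce.2))} × G →
      {j : ι // j ≠ i₀} × (ι → G) × {e // S e} × {x // B x} := fun p =>
    let h := p.1.2.2.choose_spec
    (⟨p.1.2.2.choose, h.1⟩, Function.update p.1.1.1 p.1.2.2.choose p.2,
      ⟨p.1.1.2, p.1.2.1⟩, ⟨_, h.2⟩)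
  refine Nat.card_le_card_of_injective f ?_
  rintro ⟨⟨⟨C, e⟩, h⟩, v⟩ ⟨⟨⟨C', e'⟩, h'⟩, v'⟩ hf
  simp only [f, Prod.mk.injEq, Subtype.mk.injEq] at hf
  obtain ⟨hj, hu, rfl, hd⟩ := hf
  have hne := h.2.choose_spec.1
  generalize h.2.choose = j at hj hu hd hne
  rw [← hj] at hu hd
  have hu' := fun k => congrFun hu k
  have hv : v = v' := by simpa using hu' j
  have h0 : C i₀ = C' i₀ := by simpa [Function.update_of_ne hne.symm] using hu' i₀
  have hC : C = C' := by
    funext k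
    by_cases hk : k = j
    · subst hk
      simpa [h0] using hd
    · simpa [Function.update_of_ne hk] using hu' k
  subst hC hv
  rfl

/-- Union bound on the expected block error probability of a random code of
`M` codewords, uniform i.i.d. on `Z_q^n`, over the constant-weight Lee channel:
the error vector `E` is uniform on the Lee sphere `S = {e : w_L(e) = w}` and
independent of the code, the received word is `Y = C_1 + E`, and the decoder
errs whenever some `j ≠ 1` satisfies `d_L(C_j, Y) ≤ d_L(C_1, Y)`.  The expected
error probability (computed by counting the error pairs `(C, e)` among all
`q^{nM}·|S|` equally likely pairs) is at most
`min(1, (M-1)·|{x : w_L(x) ≤ w}|/q^n)`. -/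
theorem rcu_constant_weight_union_bound (q n M : ℕ) [NeZero q] [NeZero M]
    (hq : 2 ≤ q) (hn : 1 ≤ n) (hM : 2 ≤ M) (w : ℕ)
    (hS : ∃ e : Fin n → ZMod q, leeWtVec q n e = w) :
    (Nat.card {Ce : (Fin M → (Fin n → ZMod q)) × (Fin n → ZMod q) //
        leeWtVec q n Ce.2 = w ∧
        ∃ j : Fin M, j ≠ 0 ∧
          dLeeVec q n (Ce.1 j) (Ce.1 0 + Ce.2) ≤ dLeeVec q n (Ce.1 0) (Ce.1 0 + Ce.2)} : ℝ)
      / ((q : ℝ) ^ (n * M) * (Nat.card {e : Fin n → ZMod q // leeWtVec q n e = w} : ℝ))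
    ≤ min 1 (((M : ℝ) - 1)
        * (Nat.card {x : Fin n → ZMod q // leeWtVec q n x ≤ w} : ℝ) / (q : ℝ) ^ n) := by
  have hcard : Nat.card (Fin n → ZMod q) = q ^ n := by simp
  have hcode : Nat.card (Fin M → Fin n → ZMod q) = q ^ (n * M) := by simp [pow_mul]
  have hidx : Nat.card {j : Fin M // j ≠ 0} = M - 1 := by simp
  have hq0 : (0 : ℝ) < q := by exact_mod_cast NeZero.pos q
  have hSpos : 0 < Nat.card {e : Fin n → ZMod q // leeWtVec q n e = w} := by
    obtain ⟨e, he⟩ := hS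
    have : Nonempty {e : Fin n → ZMod q // leeWtVec q n e = w} := ⟨⟨e, he⟩⟩
    exact Nat.card_pos
  have hSpos' : (0 : ℝ) < Nat.card {e : Fin n → ZMod q // leeWtVec q n e = w} := by
    exact_mod_cast hSpos
  rw [le_min_iff]
  constructor
  · rw [div_le_one (by positivity)]
    have h : Nat.card {Ce : (Fin M → (Fin n → ZMod q)) × (Fin n → ZMod q) //
        leeWtVec q n Ce.2 = w ∧ ∃ j : Fin M, j ≠ 0 ∧
          dLeeVec q n (Ce.1 j) (Ce.1 0 + Ce.2) ≤ dLeeVec q n (Ce.1 0) (Ce.1 0 + Ce.2)}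
        ≤ Nat.card ((Fin M → Fin n → ZMod q) × {e : Fin n → ZMod q // leeWtVec q n e = w}) := by
      refine Nat.card_le_card_of_injective (fun p => (p.1.1, ⟨p.1.2, p.2.1⟩)) ?_
      rintro ⟨⟨C, e⟩, h⟩ ⟨⟨C', e'⟩, h'⟩ hf
      simpa using hf
    rw [Nat.card_prod, hcode] at h
    exact_mod_cast h
  · have h := card_exists_sub_mem_mul_card_le (0 : Fin M)
      (fun e : Fin n → ZMod q => leeWtVec q n e = w) (fun x => leeWtVec q n x ≤ w)
    rw [hcard, hcode, hidx] at h
    have hset : ∀ Ce : (Fin M → (Fin n → ZMod q)) × (Fin n → ZMod q),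
        (leeWtVec q n Ce.2 = w ∧ ∃ j : Fin M, j ≠ 0 ∧
          dLeeVec q n (Ce.1 j) (Ce.1 0 + Ce.2) ≤ dLeeVec q n (Ce.1 0) (Ce.1 0 + Ce.2)) ↔
        (leeWtVec q n Ce.2 = w ∧ ∃ j : Fin M, j ≠ 0 ∧
          leeWtVec q n (Ce.1 j - (Ce.1 0 + Ce.2)) ≤ w) := by
      intro Ce
      refine and_congr_right fun he => ?_
      simp only [dLeeVec_self_add, he]
      rfl
    rw [Nat.card_congr (Equiv.subtypeEquivRight hset), div_le_div_iff₀ (by positivity)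
      (by positivity)]
    have h' := (Nat.cast_le (α := ℝ)).2 h
    push_cast [Nat.cast_sub (by omega : 1 ≤ M)] at h'
    linarith
end

section
/- (Random coding union bound for the constant-weight Lee channel.) Let q ≥ 2, n ≥ 1, M ≥ 2 be integers, let w ∈ ℕ be such that the Lee sphere S = {e ∈ Z_q^n : w_L(e) = w} is nonempty, and set δ = w/n and R = log M / (n·log q). Draw a random code C = (C_1, …, C_M) with the M codewords independent and uniformly distributed on Z_q^n, draw the error vector E uniformly on S independently of the code, and set Y = C_1 + E. Let the decoder declare an error whenever there exists an index j ≠ 1 with d_L(C_j, Y) ≤ d_L(C_1, Y). Then the expected block error probability satisfies E[P_B] ≤ exp(−n·[(1−R)·log q − H⁺_δ]⁺), where [x]⁺ = max(0, x) and H⁺_δ = inf_{β ≥ 0} (β·δ + log Z(β)). -/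
/-- The Lee sphere of radius `w` around `0`. -/
def leeSphere (q n : ℕ) [NeZero q] (w : ℕ) : Finset (Fin n → ZMod q) :=
  Finset.univ.filter fun x => leeWtVec q n x = w

/-- The Lee ball of radius `w` around `0`. -/
def leeBall (q n : ℕ) [NeZero q] (w : ℕ) : Finset (Fin n → ZMod q) :=
  Finset.univ.filter fun x => leeWtVec q n x ≤ w

theorem leeBall_nonempty (q n : ℕ) [NeZero q] (w : ℕ) : (leeBall q n w).Nonempty :=
  ⟨0, Finset.mem_filter.mpr ⟨Finset.mem_univ _, by simp [leeWtVec, leeWt]⟩⟩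

theorem Zfun_pow (q n : ℕ) [NeZero q] (β : ℝ) :
    Zfun q β ^ n = ∑ x : Fin n → ZMod q, Real.exp (-β * (leeWtVec q n x : ℝ)) := by
  rw [Zfun, Fintype.sum_pow]
  refine Finset.sum_congr rfl fun x _ => ?_
  rw [← Real.exp_sum, leeWtVec, Nat.cast_sum, Finset.mul_sum]

theorem card_leeBall_le (q n : ℕ) [NeZero q] (w : ℕ) {β : ℝ} (hβ : 0 ≤ β) :
    ((leeBall q n w).card : ℝ) ≤ Real.exp (β * w) * Zfun q β ^ n := by
  rw [Zfun_pow, Finset.mul_sum]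
  calc ((leeBall q n w).card : ℝ) = ∑ x ∈ leeBall q n w, (1 : ℝ) := by simp
    _ ≤ ∑ x ∈ leeBall q n w, Real.exp (β * w) * Real.exp (-β * (leeWtVec q n x : ℝ)) := by
        refine Finset.sum_le_sum fun x hx => ?_
        have hx' : (leeWtVec q n x : ℝ) ≤ w := by
          exact_mod_cast (Finset.mem_filter.mp hx).2
        rw [← Real.exp_add, Real.one_le_exp_iff]
        nlinarith
    _ ≤ _ := Finset.sum_le_sum_of_subset_of_nonneg (Finset.subset_univ _)
        fun _ _ _ => by positivity

theorem card_leeBall_le_exp_Hplus (q n : ℕ) [NeZero q] (hn : 1 ≤ n) (w : ℕ) :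
    ((leeBall q n w).card : ℝ) ≤ Real.exp (n * Hplus q ((w : ℝ) / n)) := by
  have hn' : (0 : ℝ) < n := by exact_mod_cast hn
  have hB : (0 : ℝ) < (leeBall q n w).card := by
    exact_mod_cast (leeBall_nonempty q n w).card_pos
  rw [← Real.log_le_iff_le_exp hB, ← div_le_iff₀' hn']
  have : Nonempty {b : ℝ // 0 ≤ b} := ⟨⟨0, le_rfl⟩⟩
  refine le_ciInf fun β => ?_
  rw [div_le_iff₀' hn']
  refine (Real.log_le_log hB (card_leeBall_le q n w β.2)).trans_eq ?_
  rw [Real.log_mul (Real.exp_pos _).ne' (pow_pos (Zfun_pos q β) n).ne', Real.log_exp, Real.log_pow]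
  field_simp

/-- Pairs (code, error vector) in the Lee sphere of radius `w` for which codeword `j` is at least
as close to the received word as the transmitted codeword. -/
def pairwiseErrorSet (q n M : ℕ) [NeZero q] [NeZero M] (w : ℕ) (j : Fin M) :
    Finset ((Fin M → (Fin n → ZMod q)) × (Fin n → ZMod q)) :=
  Finset.univ.filter fun p => leeWtVec q n p.2 = w ∧ dLeeVec q n (p.1 j) (p.1 0 + p.2) ≤ w

theorem card_pairwiseErrorSet_le (q n M : ℕ) [NeZero q] [NeZero M] (w : ℕ) {j : Fin M}
    (hj : j ≠ 0) :
    (pairwiseErrorSet q n M w j).card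
      ≤ (leeBall q n w).card * (q ^ n) ^ (M - 1) * (leeSphere q n w).card := by
  have hcard : (Fintype.piFinset fun i : Fin M =>
      if i = j then leeBall q n w else Finset.univ).card
        = (leeBall q n w).card * (q ^ n) ^ (M - 1) := by
    rw [Fintype.card_piFinset, ← Finset.mul_prod_erase _ _ (Finset.mem_univ j), if_pos rfl]
    congr 1
    rw [Finset.prod_congr rfl (g := fun _ => q ^ n) fun i hi => ?_]
    · simp
    · simp [Finset.ne_of_mem_erase hi]
  rw [← hcard, ← Finset.card_product]
  refine Finset.card_le_card_of_injOn
    (fun p => (Function.update p.1 j (p.1 j - (p.1 0 + p.2)), p.2)) ?_ ?_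
  · intro p hp
    have hp' := (Finset.mem_filter.mp hp).2
    refine Finset.mem_coe.mpr (Finset.mem_product.mpr ⟨Fintype.mem_piFinset.mpr fun i => ?_, ?_⟩)
    · by_cases hi : i = j
      · subst hi
        simpa [leeBall, dLeeVec] using hp'.2
      · simp [hi]
    · simpa [leeSphere] using hp'.1
  · rintro ⟨C, e⟩ - ⟨C', e'⟩ - h
    obtain ⟨hC, rfl⟩ := Prod.mk.inj h
    have h0 : C 0 = C' 0 := by simpa [hj.symm] using congrFun hC 0
    refine Prod.ext (funext fun i => ?_) rfl
    by_cases hi : i = j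
    · subst hi
      simpa [h0] using congrFun hC i
    · simpa [hi] using congrFun hC i

theorem card_decodingError_le (q n M : ℕ) [NeZero q] [NeZero M] (w : ℕ) :
    Nat.card {Ce : (Fin M → (Fin n → ZMod q)) × (Fin n → ZMod q) //
        leeWtVec q n Ce.2 = w ∧
        ∃ j : Fin M, j ≠ 0 ∧
          dLeeVec q n (Ce.1 j) (Ce.1 0 + Ce.2) ≤ dLeeVec q n (Ce.1 0) (Ce.1 0 + Ce.2)}
      ≤ M * ((leeBall q n w).card * (q ^ n) ^ (M - 1) * (leeSphere q n w).card) := by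
  classical
  rw [Nat.card_eq_fintype_card, Fintype.card_subtype]
  calc _ ≤ ((Finset.univ.erase (0 : Fin M)).biUnion (pairwiseErrorSet q n M w)).card := by
        refine Finset.card_le_card fun p hp => ?_
        obtain ⟨hw, j, hj, hd⟩ := (Finset.mem_filter.mp hp).2
        rw [dLeeVec_self_add, hw] at hd
        exact Finset.mem_biUnion.mpr ⟨j, Finset.mem_erase.mpr ⟨hj, Finset.mem_univ j⟩,
          Finset.mem_filter.mpr ⟨Finset.mem_univ p, hw, hd⟩⟩
    _ ≤ (Finset.univ.erase (0 : Fin M)).card * _ :=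
        Finset.card_biUnion_le_card_mul _ _ _ fun j hj =>
          card_pairwiseErrorSet_le q n M w (Finset.ne_of_mem_erase hj)
    _ ≤ _ := Nat.mul_le_mul_right _ (by simp)

theorem card_decodingError_le_total (q n M : ℕ) [NeZero q] [NeZero M] (w : ℕ) :
    Nat.card {Ce : (Fin M → (Fin n → ZMod q)) × (Fin n → ZMod q) //
        leeWtVec q n Ce.2 = w ∧
        ∃ j : Fin M, j ≠ 0 ∧
          dLeeVec q n (Ce.1 j) (Ce.1 0 + Ce.2) ≤ dLeeVec q n (Ce.1 0) (Ce.1 0 + Ce.2)}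
      ≤ q ^ (n * M) * (leeSphere q n w).card := by
  classical
  rw [Nat.card_eq_fintype_card, Fintype.card_subtype]
  calc _ ≤ ((Finset.univ : Finset (Fin M → Fin n → ZMod q)) ×ˢ leeSphere q n w).card := by
        refine Finset.card_le_card fun p hp => ?_
        simpa [leeSphere] using (Finset.mem_filter.mp hp).2.1
    _ = _ := by simp [pow_mul]

/-- Random coding union bound for the constant-weight Lee channel: with a
random code of `M` codewords uniform i.i.d. on `Z_q^n`, error vector `E`
uniform on the Lee sphere of radius `w` (independent of the code), received
word `Y = C_1 + E`, and decoding error declared whenever some `j ≠ 1`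
satisfies `d_L(C_j, Y) ≤ d_L(C_1, Y)`, the expected block error probability is
at most `exp(-n·[(1-R)·log q - H⁺_δ]⁺)` with `δ = w/n` and
`R = log M/(n·log q)`. -/
theorem rcu_constant_weight (q n M : ℕ) [NeZero q] [NeZero M]
    (hq : 2 ≤ q) (hn : 1 ≤ n) (hM : 2 ≤ M) (w : ℕ)
    (hS : ∃ e : Fin n → ZMod q, leeWtVec q n e = w) :
    (Nat.card {Ce : (Fin M → (Fin n → ZMod q)) × (Fin n → ZMod q) //
        leeWtVec q n Ce.2 = w ∧
        ∃ j : Fin M, j ≠ 0 ∧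
          dLeeVec q n (Ce.1 j) (Ce.1 0 + Ce.2) ≤ dLeeVec q n (Ce.1 0) (Ce.1 0 + Ce.2)} : ℝ)
      / ((q : ℝ) ^ (n * M) * (Nat.card {e : Fin n → ZMod q // leeWtVec q n e = w} : ℝ))
    ≤ Real.exp (-(n : ℝ) * max 0
        ((1 - Real.log M / ((n : ℝ) * Real.log q)) * Real.log q - Hplus q ((w : ℝ) / n))) := by
  have hq' : (0 : ℝ) < q := by positivity
  have hn' : (0 : ℝ) < n := by exact_mod_cast hn
  have hM' : (0 : ℝ) < M := by positivity
  have hlogq : 0 < Real.log q := Real.log_pos (by exact_mod_cast hq)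
  have hS_card : Nat.card {e : Fin n → ZMod q // leeWtVec q n e = w} = (leeSphere q n w).card := by
    rw [Nat.card_eq_fintype_card, Fintype.card_subtype, leeSphere]
  have hS_pos : (0 : ℝ) < (leeSphere q n w).card := by
    obtain ⟨e, he⟩ := hS
    exact_mod_cast Finset.card_pos.mpr ⟨e, Finset.mem_filter.mpr ⟨Finset.mem_univ e, he⟩⟩
  rw [hS_card, div_le_iff₀ (by positivity)]
  rcases max_choice 0 ((1 - Real.log M / ((n : ℝ) * Real.log q)) * Real.log q
    - Hplus q ((w : ℝ) / n)) with h | h <;> rw [h]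
  · simpa using (Nat.cast_le (α := ℝ)).mpr (card_decodingError_le_total q n M w)
  · have hexp : -(n : ℝ) * ((1 - Real.log M / ((n : ℝ) * Real.log q)) * Real.log q
        - Hplus q ((w : ℝ) / n)) = Real.log M + n * Hplus q ((w : ℝ) / n) - n * Real.log q := by
      field_simp
      ring
    have hpow : (q : ℝ) ^ (n * M) = q ^ n * (q ^ n) ^ (M - 1) := by
      rw [pow_mul, mul_pow_sub_one (by lia)]
    rw [hexp, Real.exp_sub, Real.exp_add, Real.exp_log hM', Real.exp_nat_mul (Real.log q),
      Real.exp_log hq', hpow]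
    calc _ ≤ (M : ℝ) * ((leeBall q n w).card * (q ^ n) ^ (M - 1) * (leeSphere q n w).card) := by
          exact_mod_cast card_decodingError_le q n M w
      _ ≤ M * (Real.exp (n * Hplus q ((w : ℝ) / n)) * (q ^ n) ^ (M - 1)
            * (leeSphere q n w).card) := by
          gcongr
          exact card_leeBall_le_exp_Hplus q n hn w
      _ = _ := by
          field_simp
end

section
/- (Random coding union bound for the memoryless Lee channel.) Let q ≥ 2, n ≥ 1, M ≥ 2 be integers, β > 0 real, and set R = log M / (n·log q). Draw a random code C = (C_1, …, C_M) with the M codewords independent and uniformly distributed on Z_q^n; independently, draw the error vector E ∈ Z_q^n with independent identically distributed components, each with law P(E_i = e) = exp(−β·w_L(e))/Z(β); set Y = C_1 + E and D = w_L(E). Let the decoder declare an error whenever there exists an index j ≠ 1 with d_L(C_j, Y) ≤ d_L(C_1, Y). Then the expected block error probability satisfies E[P_B] ≤ E[ exp(−n·[(1−R)·log q − H⁺_{D/n}]⁺) ], where the outer expectation is over the random Lee weight D of the error vector, [x]⁺ = max(0, x), and H⁺_δ = inf_{β′ ≥ 0} (β′·δ + log Z(β′)). -/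
theorem boltz_nonneg (q : ℕ) [NeZero q] (β : ℝ) (a : ZMod q) : 0 ≤ boltz q β a :=
  div_nonneg (Real.exp_pos _).le (Zfun_pos q β).le

/-- Chernoff bound for the size of a Lee ball. -/
theorem card_leeBall_le_exp_mul_Zfun_pow (q n t : ℕ) [NeZero q] {β : ℝ} (hβ : 0 ≤ β) :
    (Nat.card {x : Fin n → ZMod q // leeWtVec q n x ≤ t} : ℝ)
      ≤ Real.exp (β * t) * Zfun q β ^ n := by
  rw [Zfun_pow, Finset.mul_sum, Nat.card_eq_fintype_card, Fintype.card_subtype,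
    Finset.cast_card, Finset.sum_filter]
  refine Finset.sum_le_sum fun x _ => ?_
  rw [← Real.exp_add]
  split_ifs with h
  · have h' : (leeWtVec q n x : ℝ) ≤ t := by exact_mod_cast h
    exact Real.one_le_exp (by nlinarith)
  · exact (Real.exp_pos _).le

theorem card_leeBall_le_exp_Hplus_s15 (q n t : ℕ) [NeZero q] (hn : 1 ≤ n) :
    (Nat.card {x : Fin n → ZMod q // leeWtVec q n x ≤ t} : ℝ)
      ≤ Real.exp (n * Hplus q ((t : ℝ) / n)) := by
  have hn' : (0 : ℝ) < n := by exact_mod_cast hn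
  have : Nonempty {x : Fin n → ZMod q // leeWtVec q n x ≤ t} :=
    ⟨⟨0, by simp [leeWtVec, leeWt]⟩⟩
  have hB : (0 : ℝ) < Nat.card {x : Fin n → ZMod q // leeWtVec q n x ≤ t} := by
    exact_mod_cast Nat.card_pos
  rw [← Real.log_le_iff_le_exp hB, ← div_le_iff₀' hn']
  have : Nonempty {b : ℝ // 0 ≤ b} := ⟨⟨0, le_rfl⟩⟩
  refine le_ciInf fun ⟨b, hb⟩ => ?_
  rw [div_le_iff₀' hn', Real.log_le_iff_le_exp hB]
  refine (card_leeBall_le_exp_mul_Zfun_pow q n t hb).trans_eq ?_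
  rw [mul_add, Real.exp_add, Real.exp_nat_mul (Real.log _), Real.exp_log (Zfun_pos q b)]
  congr 2
  field_simp

/-- The number of families whose `j`-th member lies in a translate of `{v | p v}` by an amount
depending only on another member. -/
theorem card_translate_le {ι V : Type*} [Fintype ι] [DecidableEq ι] [AddCommGroup V] [Fintype V]
    (p : V → Prop) (e : V) {i j : ι} (hij : i ≠ j) :
    Nat.card {C : ι → V // p (C j - (C i + e))}
      ≤ Nat.card {v // p v} * Nat.card V ^ (Nat.card ι - 1) := by
  have hc : Nat.card {k : ι // k ≠ j} = Nat.card ι - 1 := by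
    rw [Nat.card_eq_fintype_card, Nat.card_eq_fintype_card]
    simp
  rw [← hc, ← Nat.card_fun, ← Nat.card_prod]
  refine Nat.card_le_card_of_injective
    (fun C => (⟨C.1 j - (C.1 i + e), C.2⟩, fun k : {k // k ≠ j} => C.1 k)) ?_
  rintro ⟨C, hC⟩ ⟨C', hC'⟩ h
  simp only [Prod.mk.injEq, Subtype.mk.injEq] at h
  obtain ⟨h₁, h₂⟩ := h
  have h₃ : ∀ k, k ≠ j → C k = C' k := fun k hk => congrFun h₂ ⟨k, hk⟩
  refine Subtype.ext (funext fun k => ?_)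
  by_cases hk : k = j
  · subst hk
    rw [h₃ i hij] at h₁
    exact sub_left_inj.mp h₁
  · exact h₃ k hk

/-- Union bound for the number of codes on which decoding fails for a given error vector. -/
theorem card_decoding_error_le (q n M : ℕ) [NeZero q] [NeZero M] (e : Fin n → ZMod q) :
    Nat.card {C : Fin M → (Fin n → ZMod q) //
        ∃ j : Fin M, j ≠ 0 ∧ dLeeVec q n (C j) (C 0 + e) ≤ dLeeVec q n (C 0) (C 0 + e)}
      ≤ M * (Nat.card {x : Fin n → ZMod q // leeWtVec q n x ≤ leeWtVec q n e}
          * (q ^ n) ^ (M - 1)) := by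
  classical
  simp only [dLeeVec_self_add]
  rw [Nat.card_eq_fintype_card, Fintype.card_subtype]
  calc _ ≤ ((Finset.univ.filter fun j : Fin M => j ≠ 0).biUnion fun j =>
        Finset.univ.filter fun C : Fin M → (Fin n → ZMod q) =>
          leeWtVec q n (C j - (C 0 + e)) ≤ leeWtVec q n e).card := by
        refine Finset.card_le_card fun C hC => ?_
        simpa [dLeeVec] using (Finset.mem_filter.mp hC).2
    _ ≤ (Finset.univ.filter fun j : Fin M => j ≠ 0).card * _ := by
        refine Finset.card_biUnion_le_card_mul _ _ _ fun j hj => ?_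
        have h := card_translate_le (fun v => leeWtVec q n v ≤ leeWtVec q n e) e
          (Finset.mem_filter.mp hj).2.symm
        rw [Nat.card_eq_fintype_card, Fintype.card_subtype] at h
        simpa only [Nat.card_fun, Nat.card_zmod, Nat.card_fin] using h
    _ ≤ _ := Nat.mul_le_mul_right _ ((Finset.card_le_univ _).trans_eq (Fintype.card_fin M))

/-- Random coding union bound for the memoryless Lee channel with parameter
`β > 0`: the code `C` has `M` codewords uniform i.i.d. on `Z_q^n`; the error
vector `E` has i.i.d. components with law `P(E_i = e) = exp(-β·w_L(e))/Z(β)`,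
independent of the code; `Y = C_1 + E`; and a decoding error is declared
whenever some `j ≠ 1` satisfies `d_L(C_j, Y) ≤ d_L(C_1, Y)`.  The expected
block error probability (written as the average over `e` of the conditional
error probability over the uniform code) is at most
`E[exp(-n·[(1-R)·log q - H⁺_{D/n}]⁺)]`, where `D = w_L(E)` and
`R = log M/(n·log q)`. -/
theorem rcu_memoryless_lee (q n M : ℕ) [NeZero q] [NeZero M]
    (hq : 2 ≤ q) (hn : 1 ≤ n) (hM : 2 ≤ M) (β : ℝ) (hβ : 0 < β) :
    ∑ e : Fin n → ZMod q, (∏ i, boltz q β (e i)) *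
        ((Nat.card {C : Fin M → (Fin n → ZMod q) //
            ∃ j : Fin M, j ≠ 0 ∧
              dLeeVec q n (C j) (C 0 + e) ≤ dLeeVec q n (C 0) (C 0 + e)} : ℝ)
          / (q : ℝ) ^ (n * M))
    ≤ ∑ e : Fin n → ZMod q, (∏ i, boltz q β (e i)) *
        Real.exp (-(n : ℝ) * max 0
          ((1 - Real.log M / ((n : ℝ) * Real.log q)) * Real.log q
            - Hplus q ((leeWtVec q n e : ℝ) / n))) := by
  refine Finset.sum_le_sum fun e _ => mul_le_mul_of_nonneg_left ?_
    (Finset.prod_nonneg fun i _ => boltz_nonneg q β (e i))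
  have hn' : (0 : ℝ) < n := by exact_mod_cast hn
  have hq' : (1 : ℝ) < q := by exact_mod_cast hq
  have hM' : (0 : ℝ) < M := by exact_mod_cast (by omega : 0 < M)
  have hqn : (0 : ℝ) < (q : ℝ) ^ (n * M) := by positivity
  have hlog : Real.log q ≠ 0 := (Real.log_pos hq').ne'
  rw [div_le_iff₀ hqn]
  rcases max_cases (0 : ℝ) ((1 - Real.log M / ((n : ℝ) * Real.log q)) * Real.log q
      - Hplus q ((leeWtVec q n e : ℝ) / n)) with ⟨h, -⟩ | ⟨h, -⟩
  · rw [h, mul_zero, Real.exp_zero, one_mul]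
    have hle := Nat.card_le_card_of_injective
      (Subtype.val : {C : Fin M → (Fin n → ZMod q) // ∃ j : Fin M, j ≠ 0 ∧
        dLeeVec q n (C j) (C 0 + e) ≤ dLeeVec q n (C 0) (C 0 + e)} → _) Subtype.val_injective
    simp only [Nat.card_fun, Nat.card_zmod, Nat.card_fin, ← pow_mul] at hle
    exact_mod_cast hle
  · rw [h]
    have hexp : Real.exp (-(n : ℝ) * ((1 - Real.log M / ((n : ℝ) * Real.log q)) * Real.log q
          - Hplus q ((leeWtVec q n e : ℝ) / n)))
        = M * Real.exp (n * Hplus q ((leeWtVec q n e : ℝ) / n)) / (q : ℝ) ^ n := by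
      have hlin : -(n : ℝ) * ((1 - Real.log M / ((n : ℝ) * Real.log q)) * Real.log q
          - Hplus q ((leeWtVec q n e : ℝ) / n))
          = Real.log M + n * Hplus q ((leeWtVec q n e : ℝ) / n) - n * Real.log q := by
        field_simp
        ring
      rw [hlin, Real.exp_sub, Real.exp_add, Real.exp_log hM', Real.exp_nat_mul (Real.log _),
        Real.exp_log (by positivity)]
    have hpow : (q : ℝ) ^ (n * M) = ((q : ℝ) ^ n) ^ (M - 1) * (q : ℝ) ^ n := by
      rw [← pow_succ, Nat.sub_add_cancel (by omega), pow_mul]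
    have hcard : (Nat.card {C : Fin M → (Fin n → ZMod q) // ∃ j : Fin M, j ≠ 0 ∧
        dLeeVec q n (C j) (C 0 + e) ≤ dLeeVec q n (C 0) (C 0 + e)} : ℝ)
        ≤ M * (Nat.card {x : Fin n → ZMod q // leeWtVec q n x ≤ leeWtVec q n e}
          * ((q : ℝ) ^ n) ^ (M - 1)) := by
      exact_mod_cast card_decoding_error_le q n M e
    calc _ ≤ _ := hcard
      _ ≤ M * (Real.exp (n * Hplus q ((leeWtVec q n e : ℝ) / n)) * ((q : ℝ) ^ n) ^ (M - 1)) := by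
        gcongr
        exact card_leeBall_le_exp_Hplus_s15 q n _ hn
      _ = _ := by
        rw [hexp, hpow]
        field_simp
end
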